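/- For any four permutations σ₁, σ₂, σ₃, σ₄ of Fin 5, there exists an injective map f : Fin 5 → ℝ² that is simultaneously a crossing-free straight-line drawing of all four paths P_{σ₁}, P_{σ₂}, P_{σ₃}, P_{σ₄}. That is, any four paths on the same five vertices admit a simultaneous geometric embedding with the given vertex mapping. -/

import Mathlib

def IsCrossingFreeDrawing {V : Type*} (G : SimpleGraph V) (f : V → ℝ × ℝ) : Prop :=
  Function.Injective f ∧
    ∀ a b c d : V, G.Adj a b → G.Adj c d → s(a, b) ≠ s(c, d) →
      segment ℝ (f a) (f b) ∩ segment ℝ (f c) (f d) = f '' (({a, b} : Set V) ∩ {c, d})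

def pathGraph {n : ℕ} (σ : Equiv.Perm (Fin n)) : SimpleGraph (Fin n) :=
  SimpleGraph.fromRel fun u v => ∃ i j : Fin n, (i : ℕ) + 1 = (j : ℕ) ∧ u = σ i ∧ v = σ j

/-- Twice the signed area of the triangle `p q r`. -/
def signedArea {R : Type*} [CommRing R] (p q r : R × R) : R :=
  (q.1 - p.1) * (r.2 - p.2) - (q.2 - p.2) * (r.1 - p.1)

theorem disjoint_segment_of_signedArea_mul_pos {p q r s : ℝ × ℝ}
    (h : 0 < signedArea p q r * signedArea p q s) :
    Disjoint (segment ℝ p q) (segment ℝ r s) := by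
  rw [Set.disjoint_left]
  rintro x ⟨a, b, -, -, hab, rfl⟩ ⟨c, d, hc, hd, hcd, hx⟩
  obtain rfl : a = 1 - b := by linarith
  have hx₁ := congrArg Prod.fst hx
  have hx₂ := congrArg Prod.snd hx
  simp only [Prod.fst_add, Prod.snd_add, Prod.smul_fst, Prod.smul_snd, smul_eq_mul] at hx₁ hx₂
  have hsum : c * signedArea p q r + d * signedArea p q s = 0 := by
    obtain rfl : c = 1 - d := by linarith
    unfold signedArea
    linear_combination (q.1 - p.1) * hx₂ - (q.2 - p.2) * hx₁
  rcases mul_pos_iff.1 h with ⟨hr, hs⟩ | ⟨hr, hs⟩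
  · nlinarith [mul_nonneg hc hr.le, mul_nonneg hd hs.le]
  · nlinarith [mul_nonneg hc (neg_nonneg.2 hr.le), mul_nonneg hd (neg_nonneg.2 hs.le)]

theorem segment_inter_segment_of_signedArea_ne_zero {p q r : ℝ × ℝ}
    (h : signedArea p q r ≠ 0) : segment ℝ p q ∩ segment ℝ p r = {p} := by
  refine Set.Subset.antisymm ?_ (Set.singleton_subset_iff.2
    ⟨left_mem_segment ℝ p q, left_mem_segment ℝ p r⟩)
  rintro x ⟨⟨a, b, -, -, hab, rfl⟩, c, d, -, -, hcd, hx⟩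
  obtain rfl : a = 1 - b := by linarith
  obtain rfl : c = 1 - d := by linarith
  have hx₁ := congrArg Prod.fst hx
  have hx₂ := congrArg Prod.snd hx
  simp only [Prod.fst_add, Prod.snd_add, Prod.smul_fst, Prod.smul_snd, smul_eq_mul] at hx₁ hx₂
  have hb : b * signedArea p q r = 0 := by
    unfold signedArea
    linear_combination (r.1 - p.1) * hx₂ - (r.2 - p.2) * hx₁
  obtain rfl : b = 0 := (mul_eq_zero.1 hb).resolve_right h
  simp

/-- Five points in general position for which, among the segments joining them, only those from
point `0` to point `1` and from point `2` to point `3` cross. -/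
def oneCrossingPoints : Fin 5 → ℤ × ℤ :=
  ![(-4, 0), (1, 1), (4, 0), (-1, 1), (0, 10)]

theorem signedArea_oneCrossingPoints_ne_zero : ∀ a b c : Fin 5, a ≠ b → a ≠ c → b ≠ c →
    signedArea (oneCrossingPoints a) (oneCrossingPoints b) (oneCrossingPoints c) ≠ 0 := by
  unfold signedArea
  decide +kernel

theorem signedArea_oneCrossingPoints_mul_pos : ∀ a b c d : Fin 5,
    a ≠ b → c ≠ d → a ≠ c → a ≠ d → b ≠ c → b ≠ d →
    s(s(a, b), s(c, d)) ≠ s(s(0, 1), s(2, 3)) →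
    0 < signedArea (oneCrossingPoints a) (oneCrossingPoints b) (oneCrossingPoints c) *
        signedArea (oneCrossingPoints a) (oneCrossingPoints b) (oneCrossingPoints d) ∨
    0 < signedArea (oneCrossingPoints c) (oneCrossingPoints d) (oneCrossingPoints a) *
        signedArea (oneCrossingPoints c) (oneCrossingPoints d) (oneCrossingPoints b) := by
  unfold signedArea
  decide +kernel

/-- The points of `oneCrossingPoints` in the real plane. -/
def oneCrossingDrawing (v : Fin 5) : ℝ × ℝ :=
  ((oneCrossingPoints v).1, (oneCrossingPoints v).2)

theorem signedArea_oneCrossingDrawing (a b c : Fin 5) :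
    signedArea (oneCrossingDrawing a) (oneCrossingDrawing b) (oneCrossingDrawing c) =
      (signedArea (oneCrossingPoints a) (oneCrossingPoints b) (oneCrossingPoints c) : ℤ) := by
  simp [signedArea, oneCrossingDrawing]

theorem oneCrossingDrawing_injective : Function.Injective oneCrossingDrawing := by
  have h : Function.Injective oneCrossingPoints := by decide
  intro a b hab
  simp only [oneCrossingDrawing, Prod.mk.injEq, Int.cast_inj] at hab
  exact h (Prod.ext hab.1 hab.2)

theorem oneCrossingDrawing_segment_inter {a b c d : Fin 5} (hab : a ≠ b) (hcd : c ≠ d)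
    (hne : s(a, b) ≠ s(c, d)) (hcross : s(s(a, b), s(c, d)) ≠ s(s(0, 1), s(2, 3))) :
    segment ℝ (oneCrossingDrawing a) (oneCrossingDrawing b) ∩
        segment ℝ (oneCrossingDrawing c) (oneCrossingDrawing d) =
      oneCrossingDrawing '' (({a, b} : Set (Fin 5)) ∩ {c, d}) := by
  have share : ∀ {u v w : Fin 5}, u ≠ v → u ≠ w → v ≠ w →
      segment ℝ (oneCrossingDrawing u) (oneCrossingDrawing v) ∩
          segment ℝ (oneCrossingDrawing u) (oneCrossingDrawing w) =
        oneCrossingDrawing '' (({u, v} : Set (Fin 5)) ∩ {u, w}) := by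
    intro u v w huv huw hvw
    have hset : (({u, v} : Set (Fin 5)) ∩ {u, w}) = {u} := by
      ext x
      simp only [Set.mem_inter_iff, Set.mem_insert_iff, Set.mem_singleton_iff]
      grind
    rw [hset, Set.image_singleton]
    apply segment_inter_segment_of_signedArea_ne_zero
    rw [signedArea_oneCrossingDrawing]
    exact_mod_cast signedArea_oneCrossingPoints_ne_zero u v w huv huw hvw
  by_cases hac : a = c
  · subst hac
    exact share hab hcd fun h => hne (by rw [h])
  by_cases had : a = d
  · subst had
    rw [segment_symm ℝ (oneCrossingDrawing c), Set.pair_comm c]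
    exact share hab hcd.symm fun h => hne (by rw [h, Sym2.eq_swap])
  by_cases hbc : b = c
  · subst hbc
    rw [segment_symm ℝ (oneCrossingDrawing a), Set.pair_comm a]
    exact share hab.symm hcd had
  by_cases hbd : b = d
  · subst hbd
    rw [segment_symm ℝ (oneCrossingDrawing a), Set.pair_comm a,
      segment_symm ℝ (oneCrossingDrawing c), Set.pair_comm c]
    exact share hab.symm hcd.symm hac
  have hset : (({a, b} : Set (Fin 5)) ∩ {c, d}) = ∅ := by
    ext x
    simp only [Set.mem_inter_iff, Set.mem_insert_iff, Set.mem_singleton_iff,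
      Set.mem_empty_iff_false]
    grind
  rw [hset, Set.image_empty, ← Set.disjoint_iff_inter_eq_empty]
  rcases signedArea_oneCrossingPoints_mul_pos a b c d hab hcd hac had hbc hbd hcross with h | h
  · apply disjoint_segment_of_signedArea_mul_pos
    simp only [signedArea_oneCrossingDrawing]
    exact_mod_cast h
  · refine (disjoint_segment_of_signedArea_mul_pos ?_).symm
    simp only [signedArea_oneCrossingDrawing]
    exact_mod_cast h

/-- The pair of disjoint edges that cross in `oneCrossingDrawing` relabelled by `π`. -/
def crossingPair (π : Equiv.Perm (Fin 5)) : Sym2 (Sym2 (Fin 5)) :=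
  s(s(π 0, π 1), s(π 2, π 3))

theorem isCrossingFreeDrawing_oneCrossingDrawing_comp {G : SimpleGraph (Fin 5)}
    {π : Equiv.Perm (Fin 5)}
    (h : ∀ a b c d, G.Adj a b → G.Adj c d → s(s(a, b), s(c, d)) ≠ crossingPair π) :
    IsCrossingFreeDrawing G (oneCrossingDrawing ∘ π.symm) := by
  refine ⟨oneCrossingDrawing_injective.comp π.symm.injective, fun a b c d hab hcd hne => ?_⟩
  obtain ⟨a, rfl⟩ := π.surjective a
  obtain ⟨b, rfl⟩ := π.surjective b
  obtain ⟨c, rfl⟩ := π.surjective c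
  obtain ⟨d, rfl⟩ := π.surjective d
  have hcross := h _ _ _ _ hab hcd
  rw [Set.image_comp, Set.image_inter π.symm.injective, Set.image_pair, Set.image_pair]
  simp only [Function.comp_apply, Equiv.symm_apply_apply]
  refine oneCrossingDrawing_segment_inter (ne_of_apply_ne π hab.ne) (ne_of_apply_ne π hcd.ne)
    (fun e => hne ?_) fun e => hcross ?_
  · simpa using congrArg (Sym2.map π) e
  · simpa [crossingPair] using congrArg (Sym2.map (Sym2.map π)) e

/-- The pairs of disjoint edges of the path visiting `σ 0, …, σ 4` in this order. -/
def disjointEdgePairs (σ : Equiv.Perm (Fin 5)) : Finset (Sym2 (Sym2 (Fin 5))) :=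
  {s(s(σ 0, σ 1), s(σ 2, σ 3)), s(s(σ 0, σ 1), s(σ 3, σ 4)), s(s(σ 1, σ 2), s(σ 3, σ 4))}

theorem exists_edge_of_pathGraph_adj {σ : Equiv.Perm (Fin 5)} {a b : Fin 5}
    (h : (pathGraph σ).Adj a b) : ∃ i : Fin 4, s(a, b) = s(σ i.castSucc, σ i.succ) := by
  rw [pathGraph, SimpleGraph.fromRel_adj] at h
  rcases h with ⟨-, ⟨i, j, hij, rfl, rfl⟩ | ⟨i, j, hij, rfl, rfl⟩⟩
  · refine ⟨⟨i, by omega⟩, ?_⟩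
    congr 3
    ext
    simp [hij]
  · refine ⟨⟨i, by omega⟩, ?_⟩
    rw [Sym2.eq_swap]
    congr 3
    ext
    simp [hij]

theorem index_pair_mem_of_disjoint : ∀ i j : Fin 4,
    s(s(i.castSucc, i.succ), s(j.castSucc, j.succ)) ∈ disjointEdgePairs 1 ∨
      ∃ k, k ∈ s(i.castSucc, i.succ) ∧ k ∈ s(j.castSucc, j.succ) := by
  decide +kernel

theorem disjointEdgePairs_eq_image (σ : Equiv.Perm (Fin 5)) :
    disjointEdgePairs σ = (disjointEdgePairs 1).image (Sym2.map (Sym2.map σ)) := by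
  simp [disjointEdgePairs, Finset.image_insert]

theorem crossingPair_disjoint {π : Equiv.Perm (Fin 5)} {e₁ e₂ : Sym2 (Fin 5)}
    (h : s(e₁, e₂) = crossingPair π) {v : Fin 5} (h₁ : v ∈ e₁) (h₂ : v ∈ e₂) : False := by
  rw [crossingPair, Sym2.eq_iff] at h
  rcases h with ⟨rfl, rfl⟩ | ⟨rfl, rfl⟩ <;>
  · simp only [Sym2.mem_iff] at h₁ h₂
    rcases h₁ with rfl | rfl <;> simp at h₂

theorem pathGraph_edge_pair_ne_crossingPair {σ π : Equiv.Perm (Fin 5)}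
    (h : crossingPair π ∉ disjointEdgePairs σ) (a b c d : Fin 5)
    (hab : (pathGraph σ).Adj a b) (hcd : (pathGraph σ).Adj c d) :
    s(s(a, b), s(c, d)) ≠ crossingPair π := by
  obtain ⟨i, hi⟩ := exists_edge_of_pathGraph_adj hab
  obtain ⟨j, hj⟩ := exists_edge_of_pathGraph_adj hcd
  rw [hi, hj]
  intro e
  rcases index_pair_mem_of_disjoint i j with hm | ⟨k, hk₁, hk₂⟩
  · apply h
    rw [← e, disjointEdgePairs_eq_image]
    exact Finset.mem_image_of_mem (Sym2.map (Sym2.map σ)) hm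
  · exact crossingPair_disjoint e (Sym2.mem_map.2 ⟨k, hk₁, rfl⟩) (Sym2.mem_map.2 ⟨k, hk₂, rfl⟩)

theorem card_image_crossingPair : (Finset.univ.image crossingPair).card = 15 := by
  decide +kernel

theorem exists_crossingPair_notMem (σ₁ σ₂ σ₃ σ₄ : Equiv.Perm (Fin 5)) :
    ∃ π, crossingPair π ∉ disjointEdgePairs σ₁ ∧ crossingPair π ∉ disjointEdgePairs σ₂ ∧
      crossingPair π ∉ disjointEdgePairs σ₃ ∧ crossingPair π ∉ disjointEdgePairs σ₄ := by
  have hcard : ∀ σ, (disjointEdgePairs σ).card ≤ 3 := fun σ => Finset.card_le_three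
  have hlt : (disjointEdgePairs σ₁ ∪ disjointEdgePairs σ₂ ∪
      (disjointEdgePairs σ₃ ∪ disjointEdgePairs σ₄)).card <
        (Finset.univ.image crossingPair).card := by
    rw [card_image_crossingPair]
    grind [Finset.card_union_le]
  obtain ⟨x, hx, hmem⟩ := Finset.exists_mem_notMem_of_card_lt_card hlt
  obtain ⟨π, -, rfl⟩ := Finset.mem_image.1 hx
  simp only [Finset.mem_union, not_or] at hmem
  exact ⟨π, hmem.1.1, hmem.1.2, hmem.2.1, hmem.2.2⟩

/-- Any four paths on the same five vertices admit a simultaneous geometric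
embedding with the given vertex mapping. -/
theorem four_paths_on_five_vertices_simultaneously_embeddable
    (σ₁ σ₂ σ₃ σ₄ : Equiv.Perm (Fin 5)) :
    ∃ f : Fin 5 → ℝ × ℝ,
      IsCrossingFreeDrawing (pathGraph σ₁) f ∧ IsCrossingFreeDrawing (pathGraph σ₂) f ∧
      IsCrossingFreeDrawing (pathGraph σ₃) f ∧ IsCrossingFreeDrawing (pathGraph σ₄) f := by
  obtain ⟨π, h₁, h₂, h₃, h₄⟩ := exists_crossingPair_notMem σ₁ σ₂ σ₃ σ₄
  exact ⟨oneCrossingDrawing ∘ π.symm,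
    isCrossingFreeDrawing_oneCrossingDrawing_comp (pathGraph_edge_pair_ne_crossingPair h₁),
    isCrossingFreeDrawing_oneCrossingDrawing_comp (pathGraph_edge_pair_ne_crossingPair h₂),
    isCrossingFreeDrawing_oneCrossingDrawing_comp (pathGraph_edge_pair_ne_crossingPair h₃),
    isCrossingFreeDrawing_oneCrossingDrawing_comp (pathGraph_edge_pair_ne_crossingPair h₄)⟩
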